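/- Let d ≥ 1 and let μ be the radial measure on ℝ^d given by dμ(y) = μ₀(‖y‖₂) dy, where μ₀ : (0,∞) → [0,∞) is measurable, not zero almost everywhere, and μ₀(t)·t^{d−1} is locally integrable on (0,∞). Suppose there exists C > 0 such that for all x ∈ ℝ^d and all r with 0 < r ≤ 1, μ(B(x·√(1−r²), r·‖x‖₂)) ≤ C · μ(B(x, r·‖x‖₂)). Then for every radial f ∈ L¹(ℝ^d, μ) and every λ > 0, λ · μ({x : M_μ f(x) > λ}) ≤ 2(C+1) · ‖f‖_{L¹(μ)}. -/

import Mathlib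

open MeasureTheory Metric

/-- The centered Hardy–Littlewood maximal operator associated to a Borel measure `μ` on
`ℝ^d`, defined with closed Euclidean balls:
`M_μ f (x) = sup { (1/μ(B̄(x,r))) ∫_{B̄(x,r)} |f| dμ : r > 0, μ(B̄(x,r)) > 0 }`. -/
noncomputable def centeredMaximal {d : ℕ} (μ : Measure (EuclideanSpace ℝ (Fin d)))
    (f : EuclideanSpace ℝ (Fin d) → ℝ) (x : EuclideanSpace ℝ (Fin d)) : ENNReal :=
  ⨆ (r : ℝ) (_ : 0 < r) (_ : 0 < μ (closedBall x r)),
    (μ (closedBall x r))⁻¹ * ∫⁻ y in closedBall x r, ENNReal.ofReal |f y| ∂μ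

/-- A function on `ℝ^d` is radial if it only depends on the distance to the origin. -/
def IsRadial {d : ℕ} (f : EuclideanSpace ℝ (Fin d) → ℝ) : Prop :=
  ∃ f₀ : ℝ → ℝ, ∀ x : EuclideanSpace ℝ (Fin d), x ≠ 0 → f x = f₀ ‖x‖

/-- The measure on `ℝ^d` with density `‖x‖₂^{-α}` with respect to Lebesgue measure. -/
noncomputable def muAlpha (d : ℕ) (α : ℝ) : Measure (EuclideanSpace ℝ (Fin d)) :=
  (volume : Measure (EuclideanSpace ℝ (Fin d))).withDensity
    (fun x => ENNReal.ofReal (‖x‖ ^ (-α)))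

/-- From a finite family of open intervals one can extract a subfamily with the same union such
that no point belongs to more than two of its members. -/
theorem exists_subset_biUnion_Ioo_eq_card_le_two (T : Finset (ℝ × ℝ)) :
    ∃ U ⊆ T, (⋃ p ∈ U, Set.Ioo p.1 p.2) = ⋃ p ∈ T, Set.Ioo p.1 p.2 ∧
      ∀ x : ℝ, (U.filter fun p => x ∈ Set.Ioo p.1 p.2).card ≤ 2 := by
  classical
  obtain ⟨U, ⟨hUT, hU⟩, hmin⟩ := exists_minimal_of_wellFoundedLT
    (fun U : Finset (ℝ × ℝ) => U ⊆ T ∧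
      (⋃ p ∈ U, Set.Ioo p.1 p.2) = ⋃ p ∈ T, Set.Ioo p.1 p.2) ⟨T, subset_rfl, rfl⟩
  refine ⟨U, hUT, hU, fun x => ?_⟩
  set V := U.filter fun p => x ∈ Set.Ioo p.1 p.2 with hV
  by_contra! hcard
  have hne : V.Nonempty := Finset.card_pos.1 (by lia)
  obtain ⟨l, hlV, hl⟩ := V.exists_min_image Prod.fst hne
  obtain ⟨r, hrV, hr⟩ := V.exists_max_image Prod.snd hne
  obtain ⟨q, hqV, hq⟩ : ∃ q ∈ V, q ∉ ({l, r} : Finset (ℝ × ℝ)) :=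
    Finset.exists_mem_notMem_of_card_lt_card (Finset.card_le_two.trans_lt hcard)
  simp only [Finset.mem_insert, Finset.mem_singleton, not_or] at hq
  simp only [hV, Finset.mem_filter, Set.mem_Ioo] at hlV hrV hqV hl hr
  have hsub : U.erase q ⊆ T := (Finset.erase_subset q U).trans hUT
  have hcover : (⋃ p ∈ U.erase q, Set.Ioo p.1 p.2) = ⋃ p ∈ T, Set.Ioo p.1 p.2 := by
    rw [← hU]
    refine Set.Subset.antisymm
      (Set.biUnion_subset_biUnion_left fun p hp => Finset.mem_of_mem_erase hp) ?_
    intro y hy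
    simp only [Set.mem_iUnion, Set.mem_Ioo, exists_prop, Finset.mem_erase] at hy ⊢
    obtain ⟨p, hpU, hp⟩ := hy
    by_cases hpq : p = q
    · subst hpq
      rcases le_or_gt y x with hyx | hyx
      · exact ⟨l, ⟨Ne.symm hq.1, hlV.1⟩, (hl p hqV).trans_lt hp.1, hyx.trans_lt hlV.2.2⟩
      · exact ⟨r, ⟨Ne.symm hq.2, hrV.1⟩, hrV.2.1.trans hyx, hp.2.trans_le (hr p hqV)⟩
    · exact ⟨p, ⟨hpq, hpU⟩, hp⟩
  exact Finset.notMem_erase q U (hmin ⟨hsub, hcover⟩ (Finset.erase_subset q U) hqV.1)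

/-- Weak type `(1,1)` estimate with constant `2` for the uncentered maximal function on the line,
for finitely many intervals. -/
theorem mul_measure_biUnion_Ioo_le_two_mul_lintegral (ν : Measure ℝ) {F : ℝ → ENNReal}
    (hF : Measurable F) (c : ENNReal) (T : Finset (ℝ × ℝ))
    (hT : ∀ p ∈ T, c * ν (Set.Ioo p.1 p.2) ≤ ∫⁻ t in Set.Ioo p.1 p.2, F t ∂ν) :
    c * ν (⋃ p ∈ T, Set.Ioo p.1 p.2) ≤ 2 * ∫⁻ t, F t ∂ν := by
  classical
  obtain ⟨U, hUT, hU, hcard⟩ := exists_subset_biUnion_Ioo_eq_card_le_two T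
  calc
    c * ν (⋃ p ∈ T, Set.Ioo p.1 p.2) ≤ c * ∑ p ∈ U, ν (Set.Ioo p.1 p.2) := by
      rw [← hU]
      gcongr
      exact measure_biUnion_finset_le _ _
    _ ≤ ∑ p ∈ U, ∫⁻ t in Set.Ioo p.1 p.2, F t ∂ν := by
      rw [Finset.mul_sum]
      exact Finset.sum_le_sum fun p hp => hT p (hUT hp)
    _ = ∫⁻ t, ∑ p ∈ U, (Set.Ioo p.1 p.2).indicator F t ∂ν := by
      rw [lintegral_finsetSum _ fun p _ => hF.indicator measurableSet_Ioo]
      simp_rw [lintegral_indicator measurableSet_Ioo]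
    _ ≤ ∫⁻ t, 2 * F t ∂ν := by
      refine lintegral_mono fun t => ?_
      simp only [Set.indicator_apply]
      rw [← Finset.sum_filter, Finset.sum_const, nsmul_eq_mul]
      gcongr
      exact_mod_cast hcard t
    _ = 2 * ∫⁻ t, F t ∂ν := lintegral_const_mul _ hF

/-- Weak type `(1,1)` estimate with constant `2` for the uncentered maximal function on the
line. -/
theorem mul_measure_iUnion_Ioo_le_two_mul_lintegral (ν : Measure ℝ) {F : ℝ → ENNReal}
    (hF : Measurable F) (c : ENNReal) (S : Set (ℝ × ℝ))
    (hS : ∀ p ∈ S, c * ν (Set.Ioo p.1 p.2) ≤ ∫⁻ t in Set.Ioo p.1 p.2, F t ∂ν) :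
    c * ν (⋃ p ∈ S, Set.Ioo p.1 p.2) ≤ 2 * ∫⁻ t, F t ∂ν := by
  classical
  obtain ⟨T, hTS, hTc, hT⟩ := TopologicalSpace.isOpen_biUnion_countable S
    (fun p => Set.Ioo p.1 p.2) fun p _ => isOpen_Ioo
  have := hTc.to_subtype
  have hunion : (⋃ p ∈ T, Set.Ioo p.1 p.2) =
      ⋃ V : Finset T, ⋃ p ∈ V, Set.Ioo p.1.1 p.1.2 := by
    rw [Set.biUnion_eq_iUnion, Set.iUnion_eq_iUnion_finset]
  rw [← hT, hunion, Directed.measure_iUnion, ENNReal.mul_iSup]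
  · refine iSup_le fun V => ?_
    have := mul_measure_biUnion_Ioo_le_two_mul_lintegral ν hF c (V.image Subtype.val) (by
      intro p hp
      obtain ⟨q, -, rfl⟩ := Finset.mem_image.1 hp
      exact hS q (hTS q.2))
    rwa [Finset.set_biUnion_finset_image] at this
  · exact directed_of_isDirected_le fun V W hVW => Set.biUnion_subset_biUnion_left hVW

/-- If the averages of `F` over all open intervals around `s` are at most `c`, then so is the
average over any order connected set of positive numbers accumulating at `s` from the left. -/
theorem setLIntegral_le_of_forall_Ioo (ν : Measure ℝ) [NullSingletonClass ν] {F : ℝ → ENNReal}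
    {c : ENNReal} {s u : ℝ}
    (hfin : ν (Set.Ioo s (s + 1)) ≠ ⊤) (hc : c ≠ ⊤)
    (hI : ∀ a b, 0 ≤ a → a < s → s < b →
      ∫⁻ t in Set.Ioo a b, F t ∂ν ≤ c * ν (Set.Ioo a b))
    {K : Set ℝ} (hK : K.OrdConnected) (hK0 : K ⊆ Set.Ioi 0) (hKb : BddAbove K) (hus : u < s)
    (huK : Set.Ioo u s ⊆ K) :
    ∫⁻ t in K, F t ∂ν ≤ c * ν K := by
  have hKa : BddBelow K := ⟨0, fun t ht => (hK0 ht).le⟩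
  have hmid : (u + s) / 2 ∈ K := huK ⟨by linarith, by linarith⟩
  set a := sInf K
  set b := sSup K
  have ha0 : 0 ≤ a := le_csInf ⟨_, hmid⟩ fun t ht => (hK0 ht).le
  have has : a < s := (csInf_le hKa hmid).trans_lt (by linarith)
  have hsb : s ≤ b := by
    refine le_of_forall_lt fun t ht => ?_
    obtain ⟨v, hv, hvs⟩ := exists_between (max_lt ht hus)
    exact ((le_max_left _ _).trans_lt hv).trans_le
      (le_csSup hKb (huK ⟨(le_max_right _ _).trans_lt hv, hvs⟩))
  have hae : K =ᵐ[ν] Set.Ioo a b := by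
    have h₁ : Set.Ioo a b ⊆ K := by
      intro t ht
      obtain ⟨p, hp, hpt⟩ := exists_lt_of_csInf_lt ⟨_, hmid⟩ ht.1
      obtain ⟨q, hq, htq⟩ := exists_lt_of_lt_csSup ⟨_, hmid⟩ ht.2
      exact hK.out hp hq ⟨hpt.le, htq.le⟩
    have h₂ : K ⊆ Set.Icc a b := fun t ht => ⟨csInf_le hKa ht, le_csSup hKb ht⟩
    exact Filter.EventuallyLE.antisymm
      (h₂.eventuallyLE.trans Ioo_ae_eq_Icc.symm.le) h₁.eventuallyLE
  rw [setLIntegral_congr hae, measure_congr hae]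
  rcases hsb.lt_or_eq with hlt | heq
  · exact hI a b ha0 has hlt
  rw [← heq]
  have hlim : Filter.Tendsto (fun n : ℕ => ν (Set.Ioo s (s + 1 / ((n : ℝ) + 1))))
      Filter.atTop (nhds 0) := by
    have hempty : (⋂ n : ℕ, Set.Ioo s (s + 1 / ((n : ℝ) + 1))) = ∅ := by
      refine Set.eq_empty_of_forall_notMem fun t ht => ?_
      rw [Set.mem_iInter] at ht
      obtain ⟨n, hn⟩ := exists_nat_one_div_lt (sub_pos.2 (ht 0).1)
      linarith [(ht n).2]
    rw [← measure_empty (μ := ν), ← hempty]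
    refine tendsto_measure_iInter_atTop (fun n => measurableSet_Ioo.nullMeasurableSet)
      (fun m n hmn => Set.Ioo_subset_Ioo_right ?_) ⟨0, by simpa using hfin⟩
    gcongr
  have hbound (n : ℕ) : ∫⁻ t in Set.Ioo a s, F t ∂ν ≤
      c * (ν (Set.Ioo a s) + ν (Set.Ioo s (s + 1 / ((n : ℝ) + 1)))) := by
    have hpos : s < s + 1 / ((n : ℝ) + 1) := by
      have : 0 < 1 / ((n : ℝ) + 1) := by positivity
      linarith
    calc
      _ ≤ ∫⁻ t in Set.Ioo a (s + 1 / ((n : ℝ) + 1)), F t ∂ν :=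
        lintegral_mono_set (Set.Ioo_subset_Ioo_right hpos.le)
      _ ≤ c * ν (Set.Ioo a (s + 1 / ((n : ℝ) + 1))) := hI _ _ ha0 has hpos
      _ ≤ _ := by
        gcongr
        rw [← Set.Ioc_union_Ioo_eq_Ioo has.le hpos, measure_congr (Ioo_ae_eq_Ioc (a := a) (b := s))]
        exact measure_union_le _ _
  refine ge_of_tendsto' (x := Filter.atTop) ?_ hbound
  simpa using ENNReal.Tendsto.const_mul (hlim.const_add (ν (Set.Ioo a s))) (Or.inr hc)

section Geometry

variable {E : Type*} [NormedAddCommGroup E] [InnerProductSpace ℝ E]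

theorem norm_smul_sub_sq_of_norm_eq_one {ω : E} (hω : ‖ω‖ = 1) (t : ℝ) (x : E) :
    ‖t • ω - x‖ ^ 2 = t ^ 2 - 2 * t * inner ℝ ω x + ‖x‖ ^ 2 := by
  rw [norm_sub_sq_real, norm_smul, real_inner_smul_left, hω, mul_one, Real.norm_eq_abs, sq_abs]
  ring

theorem smul_mem_closedBall_iff_of_norm_eq_one {ω : E} (hω : ‖ω‖ = 1) (t : ℝ) (x : E) {R : ℝ}
    (hR : 0 ≤ R) :
    t • ω ∈ closedBall x R ↔ t ^ 2 + (‖x‖ ^ 2 - R ^ 2) ≤ 2 * t * inner ℝ ω x := by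
  rw [mem_closedBall, dist_eq_norm, ← sq_le_sq₀ (norm_nonneg _) hR,
    norm_smul_sub_sq_of_norm_eq_one hω]
  constructor <;> intro h <;> linarith

/-- The positive `t` with `t ^ 2 + k ≤ 2 * t * v` form a set which is star-shaped about `√k`. -/
theorem sq_add_le_two_mul_of_between {k v t t' : ℝ} (ht : 0 < t) (ht' : 0 < t')
    (h : t ^ 2 + k ≤ 2 * t * v) (hbetween : t ≤ t' ∧ t' ≤ √k ∨ √k ≤ t' ∧ t' ≤ t) :
    t' ^ 2 + k ≤ 2 * t' * v := by
  have hprod : 0 ≤ (t - t') * (t * t' - k) := by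
    rcases hbetween with ⟨h₁, h₂⟩ | ⟨h₁, h₂⟩
    · have hk : t' ^ 2 ≤ k := (Real.le_sqrt ht'.le (Real.sqrt_pos.1 (ht'.trans_le h₂)).le).1 h₂
      exact mul_nonneg_of_nonpos_of_nonpos (by linarith) (by nlinarith)
    · have hk : k ≤ t' ^ 2 := (Real.sqrt_le_left ht'.le).1 h₁
      exact mul_nonneg (by linarith) (by nlinarith)
  have : t * (t' ^ 2 + k) ≤ t * (2 * t' * v) := by nlinarith
  exact le_of_mul_le_mul_left this ht

/-- The radii at which the ray through the unit vector `ω` meets a closed ball centered at `x`,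
completed up to the sphere through `x`, form an order connected set. -/
theorem ordConnected_ray_inter_closedBall_union_Ioo {ω : E} (hω : ‖ω‖ = 1) (x : E) {R : ℝ}
    (hR : 0 < R) (hx : x ≠ 0) :
    ({t : ℝ | 0 < t ∧ t • ω ∈ closedBall x R} ∪
      Set.Ioo √(‖x‖ ^ 2 - R ^ 2) ‖x‖).OrdConnected := by
  have hus : √(‖x‖ ^ 2 - R ^ 2) < ‖x‖ := by
    rw [Real.sqrt_lt' (norm_pos_iff.2 hx)]
    nlinarith
  refine ⟨fun p hp q hq z hz => ?_⟩
  simp only [Set.mem_union, Set.mem_ofPred_eq, Set.mem_Ioo,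
    smul_mem_closedBall_iff_of_norm_eq_one hω _ x hR.le] at hp hq ⊢
  have hp0 : 0 < p := hp.elim (·.1) fun h => (Real.sqrt_nonneg _).trans_lt h.1
  have hz0 : 0 < z := hp0.trans_le hz.1
  rcases le_or_gt z √(‖x‖ ^ 2 - R ^ 2) with hzu | hzu
  · rcases hp with hp | hp
    · exact Or.inl ⟨hz0, sq_add_le_two_mul_of_between hp0 hz0 hp.2 (Or.inl ⟨hz.1, hzu⟩)⟩
    · linarith [hz.1, hp.1]
  rcases lt_or_ge z ‖x‖ with hzs | hzs
  · exact Or.inr ⟨hzu, hzs⟩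
  rcases hq with hq | hq
  · exact Or.inl ⟨hz0, sq_add_le_two_mul_of_between hq.1 hz0 hq.2 (Or.inr ⟨hzu.le, hz.2⟩)⟩
  · linarith [hz.2, hq.2]

/-- If the ray through the unit vector `ω` meets the closed ball of center `x` and radius
`R ≤ ‖x‖`, then its part between the spheres of radii `√(‖x‖ ^ 2 - R ^ 2)` and `‖x‖` lies in the
ball of radius `R` shifted towards the origin. -/
theorem smul_mem_ball_sqrt_smul {ω x : E} (hω : ‖ω‖ = 1) (hx : x ≠ 0) {R : ℝ} (hR : 0 < R)
    (hRx : R ≤ ‖x‖) {t₀ : ℝ} (ht₀ : 0 < t₀) (hmem : t₀ • ω ∈ closedBall x R) {t : ℝ}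
    (ht : t ∈ Set.Ioo √(‖x‖ ^ 2 - R ^ 2) ‖x‖) :
    t • ω ∈ ball (√(1 - (R / ‖x‖) ^ 2) • x) R := by
  have hs : 0 < ‖x‖ := norm_pos_iff.2 hx
  rw [smul_mem_closedBall_iff_of_norm_eq_one hω _ x hR.le] at hmem
  have hk : 0 ≤ 1 - (R / ‖x‖) ^ 2 := by
    have : R / ‖x‖ ≤ 1 := (div_le_one hs).2 hRx
    have : 0 ≤ R / ‖x‖ := by positivity
    nlinarith
  set c := √(1 - (R / ‖x‖) ^ 2) with hc
  have hc0 : 0 ≤ c := Real.sqrt_nonneg _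
  have hcsq : c ^ 2 * ‖x‖ ^ 2 = ‖x‖ ^ 2 - R ^ 2 := by
    rw [hc, Real.sq_sqrt hk]
    field_simp
  have hc1 : c ≤ 1 := Real.sqrt_le_one.2 (by nlinarith [sq_nonneg (R / ‖x‖)])
  have hsqrt : √(‖x‖ ^ 2 - R ^ 2) = c * ‖x‖ := by
    rw [← hcsq, ← mul_pow, Real.sqrt_sq (by positivity)]
  rw [hsqrt] at ht
  have hinner : c * ‖x‖ ≤ inner ℝ ω x := by
    by_contra! h
    nlinarith [sq_nonneg (t₀ - c * ‖x‖)]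
  have ht0 : 0 < t := ht.1.trans_le' (by positivity)
  rw [mem_ball, dist_eq_norm, ← sq_lt_sq₀ (norm_nonneg _) hR.le,
    norm_smul_sub_sq_of_norm_eq_one hω, real_inner_smul_right, norm_smul, Real.norm_eq_abs,
    abs_of_nonneg hc0]
  have h₁ : t * c * (c * ‖x‖) ≤ t * c * inner ℝ ω x := by gcongr
  have hcc : c ^ 2 ≤ c := by nlinarith
  have h₂ : 0 < t + ‖x‖ - 2 * c ^ 2 * ‖x‖ := by nlinarith [ht.1]
  nlinarith [mul_pos (sub_pos.2 ht.2) h₂]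

end Geometry

/-- The measure on `ℝ` supported on `(0, ∞)` with density `t ↦ w t * t ^ n`. -/
noncomputable def radialProfile (n : ℕ) (w : ℝ → ℝ) : Measure ℝ :=
  (volume.restrict (Set.Ioi 0)).withDensity fun t => ENNReal.ofReal (w t * t ^ n)

instance (n : ℕ) (w : ℝ → ℝ) : SFinite (radialProfile n w) := by
  unfold radialProfile; infer_instance

instance (n : ℕ) (w : ℝ → ℝ) : NullSingletonClass (radialProfile n w) := by
  unfold radialProfile; infer_instance

theorem radialProfile_ae_pos (n : ℕ) (w : ℝ → ℝ) : ∀ᵐ t ∂radialProfile n w, 0 < t :=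
  (withDensity_absolutelyContinuous _ _).ae_le (ae_restrict_mem measurableSet_Ioi)

theorem radialProfile_Ioo_ne_top {n : ℕ} {w : ℝ → ℝ}
    (hloc : LocallyIntegrableOn (fun t => w t * t ^ n) (Set.Ioi (0 : ℝ))) {a : ℝ} (ha : 0 < a)
    (b : ℝ) : radialProfile n w (Set.Ioo a b) ≠ ⊤ := by
  have hint : IntegrableOn (fun t => w t * t ^ n) (Set.Icc a b) :=
    hloc.integrableOn_compact_subset (fun t ht => ha.trans_le ht.1) isCompact_Icc
  rw [radialProfile, withDensity_apply _ measurableSet_Ioo,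
    Measure.restrict_restrict measurableSet_Ioo]
  refine ne_top_of_le_ne_top ?_ (lintegral_mono_set
    (Set.inter_subset_left.trans Set.Ioo_subset_Icc_self))
  exact hint.lintegral_lt_top.ne

/-- Integration in polar coordinates with respect to a measure with a radial density. -/
theorem lintegral_withDensity_norm_eq_lintegral_sphere {E : Type*} [NormedAddCommGroup E]
    [NormedSpace ℝ E] [MeasurableSpace E] [BorelSpace E] [FiniteDimensional ℝ E] [Nontrivial E]
    (m : Measure E) [m.IsAddHaarMeasure] {w : ℝ → ℝ} (hw : Measurable w) {g : E → ENNReal}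
    (hg : Measurable g) :
    ∫⁻ y, g y ∂(m.withDensity fun y => ENNReal.ofReal (w ‖y‖)) =
      ∫⁻ ω, ∫⁻ t, g (t • ω.1) ∂radialProfile (Module.finrank ℝ E - 1) w ∂m.toSphere := by
  set n := Module.finrank ℝ E - 1
  have hwn : Measurable fun y : E => ENNReal.ofReal (w ‖y‖) := by fun_prop
  have hkernel : Measurable fun p : sphere (0 : E) 1 × Set.Ioi (0 : ℝ) =>
      ENNReal.ofReal (w p.2) * g (p.2.1 • p.1.1) := by
    have : Measurable fun p : sphere (0 : E) 1 × Set.Ioi (0 : ℝ) => p.2.1 • p.1.1 := by fun_prop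
    fun_prop
  rw [lintegral_withDensity_eq_lintegral_mul _ hwn hg]
  calc
    ∫⁻ y, ((fun y : E => ENNReal.ofReal (w ‖y‖)) * g : E → ENNReal) y ∂m
      = ∫⁻ y : ({0}ᶜ : Set E), ENNReal.ofReal (w ‖y.1‖) * g y.1 ∂(m.comap (↑)) := by
        rw [lintegral_subtype_comap (measurableSet_singleton _).compl
          (fun y : E => ENNReal.ofReal (w ‖y‖) * g y), restrict_compl_singleton]
        rfl
    _ = ∫⁻ p, ENNReal.ofReal (w p.2.1) * g (p.2.1 • p.1.1)
          ∂(m.toSphere.prod (Measure.volumeIoiPow n)) := by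
        rw [← m.measurePreserving_homeomorphUnitSphereProd.lintegral_comp hkernel]
        refine lintegral_congr fun y => ?_
        have hy : ‖y.1‖ ≠ 0 := norm_ne_zero_iff.2 y.2
        simp [smul_smul, hy]
    _ = ∫⁻ ω, ∫⁻ t : Set.Ioi (0 : ℝ), ENNReal.ofReal (w t) * g (t.1 • ω.1)
          ∂Measure.volumeIoiPow n ∂m.toSphere := lintegral_prod _ hkernel.aemeasurable
    _ = ∫⁻ ω, ∫⁻ t, g (t • ω.1) ∂radialProfile n w ∂m.toSphere := by
        refine lintegral_congr fun ω => ?_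
        have hgω : Measurable fun t : ℝ => g (t • ω.1) := by fun_prop
        rw [Measure.volumeIoiPow, radialProfile,
          lintegral_withDensity_eq_lintegral_mul _ (by fun_prop) (by fun_prop),
          lintegral_withDensity_eq_lintegral_mul _ (by fun_prop) hgω,
          ← lintegral_subtype_comap measurableSet_Ioi]
        refine lintegral_congr fun t => ?_
        have ht : (0 : ℝ) < t.1 := t.2
        simp only [Pi.mul_apply]
        rw [ENNReal.ofReal_mul' (by positivity)]
        ring

section Polar

variable {E : Type*} [NormedAddCommGroup E] [InnerProductSpace ℝ E]

theorem norm_smul_of_mem_unit_sphere (ω : sphere (0 : E) 1) {t : ℝ} (ht : 0 < t) :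
    ‖t • ω.1‖ = t := by
  rw [norm_smul, norm_eq_of_mem_sphere ω, mul_one, Real.norm_of_nonneg ht.le]

variable [MeasurableSpace E] [BorelSpace E]

theorem measure_eq_lintegral_measure_ray {μ : Measure E} {ν : Measure ℝ}
    {σ : Measure (sphere (0 : E) 1)}
    (hpolar : ∀ g : E → ENNReal, Measurable g →
      ∫⁻ y, g y ∂μ = ∫⁻ ω, ∫⁻ t, g (t • ω.1) ∂ν ∂σ)
    {A : Set E} (hA : MeasurableSet A) : μ A = ∫⁻ ω, ν {t : ℝ | t • ω.1 ∈ A} ∂σ := by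
  rw [← lintegral_indicator_one hA, hpolar _ (measurable_one.indicator hA)]
  refine lintegral_congr fun ω => ?_
  have hm : MeasurableSet {t : ℝ | t • ω.1 ∈ A} := by
    have : Measurable fun t : ℝ => t • ω.1 := by fun_prop
    exact this hA
  rw [← lintegral_indicator_one hm]
  rfl

theorem measurable_measure_ray [SecondCountableTopology E] (ν : Measure ℝ) [SFinite ν] {A : Set E} (hA : MeasurableSet A) :
    Measurable fun ω : sphere (0 : E) 1 => ν {t : ℝ | t • ω.1 ∈ A} := by
  have hm : Measurable fun p : sphere (0 : E) 1 × ℝ => p.2 • p.1.1 := by fun_prop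
  exact measurable_measure_prodMk_left (hm hA)

/-- Integrals of radial functions over balls are controlled by the averages of their profiles over
intervals. -/
theorem setLIntegral_closedBall_norm_le [SecondCountableTopology E] {μ : Measure E} {ν : Measure ℝ} [SFinite ν]
    [NullSingletonClass ν] {σ : Measure (sphere (0 : E) 1)}
    (hpolar : ∀ g : E → ENNReal, Measurable g →
      ∫⁻ y, g y ∂μ = ∫⁻ ω, ∫⁻ t, g (t • ω.1) ∂ν ∂σ)
    (hpos : ∀ᵐ t ∂ν, 0 < t) {D : ENNReal}
    (hshift : ∀ x : E, ∀ r : ℝ, 0 < r → r ≤ 1 →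
      μ (ball (√(1 - r ^ 2) • x) (r * ‖x‖)) ≤ D * μ (ball x (r * ‖x‖)))
    {F : ℝ → ENNReal} (hF : Measurable F) {c : ENNReal} (hc : c ≠ ⊤) {x : E} (hx : x ≠ 0)
    (hfin : ν (Set.Ioo ‖x‖ (‖x‖ + 1)) ≠ ⊤)
    (hI : ∀ a b, 0 ≤ a → a < ‖x‖ → ‖x‖ < b →
      ∫⁻ t in Set.Ioo a b, F t ∂ν ≤ c * ν (Set.Ioo a b))
    {R : ℝ} (hR : 0 < R) :
    ∫⁻ y in closedBall x R, F ‖y‖ ∂μ ≤ c * (1 + D) * μ (closedBall x R) := by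
  have hs : 0 < ‖x‖ := norm_pos_iff.2 hx
  have hus : √(‖x‖ ^ 2 - R ^ 2) < ‖x‖ := by
    rw [Real.sqrt_lt' hs]
    nlinarith
  obtain ⟨z, ρ, hle, hmem⟩ : ∃ z ρ, μ (ball z ρ) ≤ D * μ (closedBall x R) ∧
      ∀ ω : sphere (0 : E) 1, ∀ t₀ : ℝ, 0 < t₀ → t₀ • ω.1 ∈ closedBall x R →
        ∀ t ∈ Set.Ioo √(‖x‖ ^ 2 - R ^ 2) ‖x‖, t • ω.1 ∈ ball z ρ := by
    rcases le_or_gt R ‖x‖ with hRx | hRx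
    · refine ⟨√(1 - (R / ‖x‖) ^ 2) • x, R, ?_, fun ω t₀ ht₀ h t ht =>
        smul_mem_ball_sqrt_smul (norm_eq_of_mem_sphere ω) hx hR hRx ht₀ h ht⟩
      have h := hshift x (R / ‖x‖) (by positivity) ((div_le_one hs).2 hRx)
      rw [div_mul_cancel₀ _ hs.ne'] at h
      exact h.trans (by gcongr; exact ball_subset_closedBall)
    · refine ⟨0, ‖x‖, ?_, fun ω t₀ ht₀ h t ht => ?_⟩
      · have h := hshift x 1 one_pos le_rfl
        rw [one_pow, sub_self, Real.sqrt_zero, zero_smul, one_mul] at h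
        exact h.trans (by gcongr; exact (ball_subset_ball hRx.le).trans ball_subset_closedBall)
      · rw [mem_ball_zero_iff,
          norm_smul_of_mem_unit_sphere ω ((Real.sqrt_nonneg _).trans_lt ht.1)]
        exact ht.2
  have hray (ω : sphere (0 : E) 1) :
      ∫⁻ t, (closedBall x R).indicator (fun y => F ‖y‖) (t • ω.1) ∂ν ≤
        c * (ν {t : ℝ | t • ω.1 ∈ closedBall x R} + ν {t : ℝ | t • ω.1 ∈ ball z ρ}) := by
    set J : Set ℝ := {t : ℝ | 0 < t ∧ t • ω.1 ∈ closedBall x R} with hJ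
    have hJm : MeasurableSet J := by
      have : Measurable fun t : ℝ => t • ω.1 := by fun_prop
      exact measurableSet_Ioi.inter (this measurableSet_closedBall)
    have heq : ∫⁻ t, (closedBall x R).indicator (fun y => F ‖y‖) (t • ω.1) ∂ν =
        ∫⁻ t in J, F t ∂ν := by
      rw [← lintegral_indicator hJm]
      refine lintegral_congr_ae (hpos.mono fun t ht => ?_)
      have hiff : t ∈ J ↔ t • ω.1 ∈ closedBall x R := and_iff_right ht
      change (closedBall x R).indicator (fun y => F ‖y‖) (t • ω.1) = J.indicator F t
      by_cases htJ : t ∈ J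
      · rw [Set.indicator_of_mem htJ, Set.indicator_of_mem (hiff.1 htJ),
          norm_smul_of_mem_unit_sphere ω ht]
      · rw [Set.indicator_of_notMem htJ, Set.indicator_of_notMem (mt hiff.2 htJ)]
    rw [heq]
    rcases J.eq_empty_or_nonempty with hemp | ⟨t₀, ht₀, ht₀'⟩
    · simp [hemp]
    have hbdd : BddAbove (J ∪ Set.Ioo √(‖x‖ ^ 2 - R ^ 2) ‖x‖) := by
      refine BddAbove.union ⟨‖x‖ + R, fun t ht => ?_⟩ bddAbove_Ioo
      have h := norm_le_of_mem_closedBall ht.2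
      rwa [norm_smul_of_mem_unit_sphere ω ht.1] at h
    calc
      ∫⁻ t in J, F t ∂ν ≤ ∫⁻ t in J ∪ Set.Ioo √(‖x‖ ^ 2 - R ^ 2) ‖x‖, F t ∂ν :=
        lintegral_mono_set Set.subset_union_left
      _ ≤ c * ν (J ∪ Set.Ioo √(‖x‖ ^ 2 - R ^ 2) ‖x‖) :=
        setLIntegral_le_of_forall_Ioo ν hfin hc hI
          (ordConnected_ray_inter_closedBall_union_Ioo (norm_eq_of_mem_sphere ω) x hR hx)
          (Set.union_subset (fun t ht => ht.1) fun t ht => (Real.sqrt_nonneg _).trans_lt ht.1)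
          hbdd hus Set.subset_union_right
      _ ≤ _ := by
        gcongr
        refine (measure_union_le _ _).trans (add_le_add (measure_mono fun t ht => ht.2)
          (measure_mono fun t ht => hmem ω t₀ ht₀ ht₀' t ht))
  calc
    ∫⁻ y in closedBall x R, F ‖y‖ ∂μ
      = ∫⁻ ω, ∫⁻ t, (closedBall x R).indicator (fun y => F ‖y‖) (t • ω.1) ∂ν ∂σ := by
        rw [← lintegral_indicator measurableSet_closedBall,
          hpolar _ (Measurable.indicator (by fun_prop) measurableSet_closedBall)]
    _ ≤ ∫⁻ ω, c * (ν {t : ℝ | t • ω.1 ∈ closedBall x R} + ν {t : ℝ | t • ω.1 ∈ ball z ρ}) ∂σ :=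
        lintegral_mono hray
    _ = c * (μ (closedBall x R) + μ (ball z ρ)) := by
        rw [lintegral_const_mul' _ _ hc,
          lintegral_add_left (measurable_measure_ray ν measurableSet_closedBall),
          measure_eq_lintegral_measure_ray hpolar measurableSet_closedBall,
          measure_eq_lintegral_measure_ray hpolar measurableSet_ball]
    _ ≤ c * (μ (closedBall x R) + D * μ (closedBall x R)) := by gcongr
    _ = c * (1 + D) * μ (closedBall x R) := by ring

theorem measure_preimage_norm_eq {μ : Measure E} {ν : Measure ℝ}
    {σ : Measure (sphere (0 : E) 1)}
    (hpolar : ∀ g : E → ENNReal, Measurable g →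
      ∫⁻ y, g y ∂μ = ∫⁻ ω, ∫⁻ t, g (t • ω.1) ∂ν ∂σ)
    (hpos : ∀ᵐ t ∂ν, 0 < t) {A : Set ℝ} (hA : MeasurableSet A) :
    μ (norm ⁻¹' A) = ν A * σ Set.univ := by
  rw [measure_eq_lintegral_measure_ray hpolar (measurable_norm hA), ← lintegral_const]
  refine lintegral_congr fun ω => measure_congr (hpos.mono fun t ht => ?_)
  refine propext ?_
  change ‖t • ω.1‖ ∈ A ↔ t ∈ A
  rw [norm_smul_of_mem_unit_sphere ω ht]

theorem lintegral_norm_eq {μ : Measure E} {ν : Measure ℝ} {σ : Measure (sphere (0 : E) 1)}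
    (hpolar : ∀ g : E → ENNReal, Measurable g →
      ∫⁻ y, g y ∂μ = ∫⁻ ω, ∫⁻ t, g (t • ω.1) ∂ν ∂σ)
    (hpos : ∀ᵐ t ∂ν, 0 < t) {F : ℝ → ENNReal} (hF : Measurable F) :
    ∫⁻ y, F ‖y‖ ∂μ = (∫⁻ t, F t ∂ν) * σ Set.univ := by
  rw [hpolar _ (by fun_prop), ← lintegral_const]
  refine lintegral_congr fun ω => lintegral_congr_ae (hpos.mono fun t ht => ?_)
  simp only [norm_smul_of_mem_unit_sphere ω ht]

/-- An almost everywhere measurable radial function has a measurable profile. -/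
theorem exists_measurable_profile [SecondCountableTopology E] {μ : Measure E} {ν : Measure ℝ} [SFinite ν]
    {σ : Measure (sphere (0 : E) 1)} (hσ : σ ≠ 0)
    (hpolar : ∀ g : E → ENNReal, Measurable g →
      ∫⁻ y, g y ∂μ = ∫⁻ ω, ∫⁻ t, g (t • ω.1) ∂ν ∂σ)
    (hpos : ∀ᵐ t ∂ν, 0 < t) {h : E → ENNReal} (hh : AEMeasurable h μ) {h₀ : ℝ → ENNReal}
    (hrad : ∀ y, y ≠ 0 → h y = h₀ ‖y‖) :
    ∃ F : ℝ → ENNReal, Measurable F ∧ ∀ᵐ y ∂μ, h y = F ‖y‖ := by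
  obtain ⟨N, hN, hNm, hN0⟩ := exists_measurable_superset_of_null hh.ae_eq_mk
  have hrays : ∀ᵐ ω ∂σ, ν {t : ℝ | t • ω.1 ∈ N} = 0 := by
    rw [measure_eq_lintegral_measure_ray hpolar hNm] at hN0
    exact (lintegral_eq_zero_iff (measurable_measure_ray ν hNm)).1 hN0
  have : NeZero σ := ⟨hσ⟩
  obtain ⟨ω, hω⟩ := hrays.exists
  have hmk : Measurable fun t : ℝ => hh.mk h (t • ω.1) :=
    hh.measurable_mk.comp (by fun_prop)
  refine ⟨fun t => hh.mk h (t • ω.1), hmk, ?_⟩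
  have hprofile : ∀ᵐ t ∂ν, h₀ t = hh.mk h (t • ω.1) := by
    have hnot : ∀ᵐ t ∂ν, t • ω.1 ∉ N := by
      rw [ae_iff]
      simpa using hω
    filter_upwards [hpos, hnot] with t ht htN
    have hnorm := norm_smul_of_mem_unit_sphere ω ht
    have heq := hrad (t • ω.1) (norm_pos_iff.1 (hnorm.symm ▸ ht))
    rw [hnorm] at heq
    rw [← heq]
    by_contra hne
    exact htN (hN hne)
  obtain ⟨M, hM, hMm, hM0⟩ := exists_measurable_superset_of_null hprofile
  have hμM : ∀ᵐ y ∂μ, ‖y‖ ∉ M := by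
    have := measure_preimage_norm_eq hpolar hpos hMm
    rw [hM0, zero_mul] at this
    exact measure_eq_zero_iff_ae_notMem.1 this
  have hμ0 : ∀ᵐ y ∂μ, y ≠ 0 := by
    have := measure_preimage_norm_eq hpolar hpos (measurableSet_Iic (a := (0 : ℝ)))
    rw [show ν (Set.Iic 0) = 0 by simpa [ae_iff, Set.Iic] using hpos, zero_mul] at this
    rw [ae_iff]
    refine measure_mono_null (fun y hy => ?_) this
    simp at hy
    simp [hy]
  filter_upwards [hμM, hμ0] with y hyM hy0
  rw [hrad y hy0]
  by_contra hne
  exact hyM (hM hne)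

end Polar

/-- Theorem (main_teo): let `μ` be a radial measure on `ℝ^d`, `dμ(y) = μ₀(‖y‖₂) dy`, and suppose
that there is `C > 0` such that shifting balls `B(x, r‖x‖₂)` (with `0 < r ≤ 1`) towards the origin
to `B(x√(1−r²), r‖x‖₂)` increases their measure at most by a factor `C`. Then the centered maximal
operator, acting on radial functions, satisfies a weak type `(1,1)` inequality with constant
`2(C+1)`. -/
theorem radial_weak_one_one (d : ℕ) (hd : 1 ≤ d) (μ₀ : ℝ → ℝ) (hmeas : Measurable μ₀)
    (hnonneg : ∀ t ∈ Set.Ioi (0 : ℝ), 0 ≤ μ₀ t)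
    (hne : ¬ (∀ᵐ t ∂(volume.restrict (Set.Ioi (0 : ℝ))), μ₀ t = 0))
    (hloc : LocallyIntegrableOn (fun t => μ₀ t * t ^ (d - 1)) (Set.Ioi (0 : ℝ)))
    (μ : Measure (EuclideanSpace ℝ (Fin d)))
    (hμ : μ = volume.withDensity fun y => ENNReal.ofReal (μ₀ ‖y‖))
    (C : ℝ) (hC : 0 < C)
    (hshift : ∀ x : EuclideanSpace ℝ (Fin d), ∀ r : ℝ, 0 < r → r ≤ 1 →
      μ (ball (Real.sqrt (1 - r ^ 2) • x) (r * ‖x‖)) ≤ ENNReal.ofReal C * μ (ball x (r * ‖x‖)))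
    (f : EuclideanSpace ℝ (Fin d) → ℝ) (hrad : IsRadial f) (hint : Integrable f μ)
    (lam : ℝ) (hlam : 0 < lam) :
    ENNReal.ofReal lam * μ {x | ENNReal.ofReal lam < centeredMaximal μ f x} ≤
      ENNReal.ofReal (2 * (C + 1)) * ∫⁻ x, ENNReal.ofReal |f x| ∂μ := by
  have : Nonempty (Fin d) := ⟨⟨0, hd⟩⟩
  set ν := radialProfile (d - 1) μ₀
  set σ := (volume : Measure (EuclideanSpace ℝ (Fin d))).toSphere
  have hpolar : ∀ g : EuclideanSpace ℝ (Fin d) → ENNReal, Measurable g →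
      ∫⁻ y, g y ∂μ = ∫⁻ ω, ∫⁻ t, g (t • ω.1) ∂ν ∂σ := by
    intro g hg
    rw [hμ, lintegral_withDensity_norm_eq_lintegral_sphere volume hmeas hg,
      finrank_euclideanSpace_fin]
  have hpos : ∀ᵐ t ∂ν, 0 < t := radialProfile_ae_pos _ _
  obtain ⟨f₀, hf₀⟩ := hrad
  obtain ⟨F, hF, hfF⟩ := exists_measurable_profile (Measure.toSphere_ne_zero volume) hpolar hpos
    (h := fun y => ENNReal.ofReal |f y|) (h₀ := fun t => ENNReal.ofReal |f₀ t|)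
    hint.aemeasurable.abs.ennreal_ofReal fun y hy => by rw [hf₀ y hy]
  set c := ENNReal.ofReal (lam / (C + 1)) with hc
  have hclam : c * ENNReal.ofReal (C + 1) = ENNReal.ofReal lam := by
    rw [hc, ← ENNReal.ofReal_mul (by positivity), div_mul_cancel₀ _ (by positivity)]
  set S : Set (ℝ × ℝ) :=
    {p | c * ν (Set.Ioo p.1 p.2) ≤ ∫⁻ t in Set.Ioo p.1 p.2, F t ∂ν}
  set U := ⋃ p ∈ S, Set.Ioo p.1 p.2
  have hUm : MeasurableSet U := (isOpen_biUnion fun p _ => isOpen_Ioo).measurableSet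
  have hsub : {x | ENNReal.ofReal lam < centeredMaximal μ f x} ⊆
      {0} ∪ norm ⁻¹' U := by
    intro x hx
    by_contra hxU
    simp only [Set.mem_union, Set.mem_singleton_iff, Set.mem_preimage, not_or] at hxU
    obtain ⟨hx0, hxU⟩ := hxU
    refine (not_le.2 (show ENNReal.ofReal lam < centeredMaximal μ f x from hx)) ?_
    have hI : ∀ a b, 0 ≤ a → a < ‖x‖ → ‖x‖ < b →
        ∫⁻ t in Set.Ioo a b, F t ∂ν ≤ c * ν (Set.Ioo a b) := by
      intro a b _ ha hb
      by_contra! h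
      exact hxU (Set.mem_biUnion (show (a, b) ∈ S from h.le) ⟨ha, hb⟩)
    refine iSup_le fun R => iSup_le fun hR => iSup_le fun hm => ?_
    have hbound := setLIntegral_closedBall_norm_le hpolar hpos hshift hF
      (c := c) ENNReal.ofReal_ne_top hx0
      (radialProfile_Ioo_ne_top hloc (norm_pos_iff.2 hx0) _) hI hR
    rw [← ENNReal.ofReal_one, ← ENNReal.ofReal_add zero_le_one hC.le, add_comm 1 C, hclam,
      ← setLIntegral_congr_fun_ae measurableSet_closedBall (hfF.mono fun y hy _ => hy)] at hbound
    calc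
      _ ≤ (μ (closedBall x R))⁻¹ * (ENNReal.ofReal lam * μ (closedBall x R)) := by gcongr
      _ = ENNReal.ofReal lam * ((μ (closedBall x R))⁻¹ * μ (closedBall x R)) := by ring
      _ ≤ ENNReal.ofReal lam := mul_le_of_le_one_right' (ENNReal.inv_mul_le_one _)
  have hzero : μ {0} = 0 := by
    rw [hμ]
    exact measure_singleton 0
  calc
    ENNReal.ofReal lam * μ {x | ENNReal.ofReal lam < centeredMaximal μ f x}
      ≤ ENNReal.ofReal lam * μ (norm ⁻¹' U) := by
        gcongr ENNReal.ofReal lam * ?_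
        refine (measure_mono hsub).trans ((measure_union_le _ _).trans ?_)
        rw [hzero, zero_add]
    _ = ENNReal.ofReal (C + 1) * (c * ν U) * σ Set.univ := by
        rw [measure_preimage_norm_eq hpolar hpos hUm, ← hclam]
        ring
    _ ≤ ENNReal.ofReal (C + 1) * (2 * ∫⁻ t, F t ∂ν) * σ Set.univ := by
        gcongr ENNReal.ofReal (C + 1) * ?_ * σ Set.univ
        exact mul_measure_iUnion_Ioo_le_two_mul_lintegral ν hF c S fun p hp => hp
    _ = ENNReal.ofReal (2 * (C + 1)) * ∫⁻ x, ENNReal.ofReal |f x| ∂μ := by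
        rw [lintegral_congr_ae hfF, lintegral_norm_eq hpolar hpos hF,
          ENNReal.ofReal_mul zero_le_two, ENNReal.ofReal_ofNat]
        ring
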